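/- Let H : 2^V → ℝ be a polymatroid rank function on a finite set V with |V| ≥ 2, let R := max_{P ∈ Π′(V)} φ(P), let ĝ := ĝ_R be the Dilworth truncation of f#_R, and let P* ∈ Π′(V) be the fundamental partition (φ(P*) = R and P* refines every P ∈ Π′(V) with φ(P) = R). For each nonempty C ⊆ V let B_C := { ρ ∈ ℝ^C : Σ_{i∈X} ρ_i ≤ ĝ(X) for all nonempty X ⊆ C, and Σ_{i∈C} ρ_i = ĝ(C) }. Let g_i : ℝ → ℝ be convex for each i ∈ V, and suppose r* ∈ ℝ^V is such that for every C ∈ P*, the restriction of r* to C lies in B_C and minimizes Σ_{i∈C} g_i(ρ_i) over ρ ∈ B_C. Then r* ∈ RCO(V) with r*(V) = R, and r* minimizes the separable convex function Σ_{i∈V} g_i(r_i) over the optimal rate vector set { r ∈ RCO(V) : r(V) = R }. -/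

import Mathlib

/-- `H` is a polymatroid rank function: normalized, monotone and submodular. -/
def IsPolymatroid {V : Type*} [Fintype V] [DecidableEq V] (H : Finset V → ℝ) : Prop :=
  H ∅ = 0 ∧ (∀ X Y : Finset V, Y ⊆ X → H Y ≤ H X) ∧
    (∀ X Y : Finset V, H (X ∪ Y) + H (X ∩ Y) ≤ H X + H Y)

/-- `f#_α`: the dual set function, `f#_α(∅) = 0` and `f#_α(X) = α − H(V) + H(X)` for `X ≠ ∅`. -/
noncomputable def fHash {V : Type*} [Fintype V] [DecidableEq V]
    (H : Finset V → ℝ) (α : ℝ) (X : Finset V) : ℝ :=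
  if X = ∅ then 0 else α - H Finset.univ + H X

/-- `P` is a partition of `X`: a collection of pairwise disjoint nonempty sets with union `X`. -/
def IsPartitionOf {V : Type*} [DecidableEq V] (X : Finset V) (P : Finset (Finset V)) : Prop :=
  (∀ C ∈ P, C.Nonempty) ∧ (∀ C ∈ P, ∀ D ∈ P, C ≠ D → Disjoint C D) ∧ P.biUnion id = X

/-- The Dilworth truncation `ĝ_α(X) = min_{P ∈ Π(X)} Σ_{C ∈ P} f#_α(C)` (with `ĝ_α(∅) = 0`,
obtained from the empty partition). -/
noncomputable def dilworth {V : Type*} [Fintype V] [DecidableEq V]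
    (H : Finset V → ℝ) (α : ℝ) (X : Finset V) : ℝ :=
  sInf { s : ℝ | ∃ P : Finset (Finset V), IsPartitionOf X P ∧ s = ∑ C ∈ P, fHash H α C }

/-- `φ(P) = Σ_{C∈P} (H(V) − H(C)) / (|P| − 1)`. -/
noncomputable def phi {V : Type*} [Fintype V] [DecidableEq V]
    (H : Finset V → ℝ) (P : Finset (Finset V)) : ℝ :=
  (∑ C ∈ P, (H Finset.univ - H C)) / ((P.card : ℝ) - 1)

/-- The achievable rate region for communication for omniscience:
`r(X) ≥ H(V) − H(V∖X)` for all proper subsets `X ⊊ V`. -/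
def RCO {V : Type*} [Fintype V] [DecidableEq V] (H : Finset V → ℝ) : Set (V → ℝ) :=
  { r | ∀ X : Finset V, X ⊂ Finset.univ →
      H Finset.univ - H (Finset.univ \ X) ≤ ∑ i ∈ X, r i }

/-- `ρ` (restricted to `C`) lies in `B_C`, the projection of `B(ĝ_R, ≤)` on `C`. -/
def InBC {V : Type*} [Fintype V] [DecidableEq V]
    (H : Finset V → ℝ) (R : ℝ) (C : Finset V) (ρ : V → ℝ) : Prop :=
  (∀ X : Finset V, X.Nonempty → X ⊆ C → ∑ i ∈ X, ρ i ≤ dilworth H R X) ∧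
    ∑ i ∈ C, ρ i = dilworth H R C

section Partitions

variable {V : Type*} [DecidableEq V]

theorem IsPartitionOf.sum_sum {X : Finset V} {P : Finset (Finset V)} (hP : IsPartitionOf X P)
    (h : V → ℝ) : ∑ C ∈ P, ∑ i ∈ C, h i = ∑ i ∈ X, h i := by
  obtain ⟨-, hd, rfl⟩ := hP
  exact (Finset.sum_biUnion fun C hC D hD hne => hd C hC D hD hne).symm

theorem IsPartitionOf.sum_inter {X : Finset V} {P : Finset (Finset V)} (hP : IsPartitionOf X P)
    (h : V → ℝ) {Y : Finset V} (hY : Y ⊆ X) :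
    ∑ C ∈ P, ∑ i ∈ Y ∩ C, h i = ∑ i ∈ Y, h i := by
  have := hP.sum_sum fun i => if i ∈ Y then h i else 0
  rw [Finset.sum_ite_mem, Finset.inter_eq_right.2 hY] at this
  rw [← this]
  refine Finset.sum_congr rfl fun C _ => ?_
  rw [Finset.sum_ite_mem, Finset.inter_comm]

theorem isPartitionOf_singleton {X : Finset V} (hX : X.Nonempty) : IsPartitionOf X {X} := by
  refine ⟨by simpa using hX, ?_, by simp⟩
  intro C hC D hD hne
  simp_all

/-- Replacing the subfamily `S` of a partition by a partition `Q` of the union of `S`. -/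
theorem IsPartitionOf.replace {X : Finset V} {P S Q : Finset (Finset V)} (hP : IsPartitionOf X P)
    (hS : S ⊆ P) (hQ : IsPartitionOf (S.biUnion id) Q) :
    IsPartitionOf X (P \ S ∪ Q) ∧ Disjoint (P \ S) Q := by
  obtain ⟨hPn, hPd, hPu⟩ := hP
  obtain ⟨hQn, hQd, hQu⟩ := hQ
  have key : ∀ C ∈ P \ S, ∀ D ∈ Q, Disjoint C D := by
    intro C hC D hD
    rw [Finset.mem_sdiff] at hC
    have hDU : D ⊆ S.biUnion id := hQu ▸ Finset.subset_biUnion_of_mem id hD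
    refine Finset.disjoint_of_subset_right hDU ((Finset.disjoint_biUnion_right _ _ _).2 ?_)
    exact fun E hE => hPd C hC.1 E (hS hE) fun h => hC.2 (h ▸ hE)
  refine ⟨⟨?_, ?_, ?_⟩, ?_⟩
  · intro C hC
    rcases Finset.mem_union.1 hC with h | h
    · exact hPn C (Finset.mem_sdiff.1 h).1
    · exact hQn C h
  · intro C hC D hD hne
    rcases Finset.mem_union.1 hC with h | h <;> rcases Finset.mem_union.1 hD with h' | h'
    · exact hPd C (Finset.mem_sdiff.1 h).1 D (Finset.mem_sdiff.1 h').1 hne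
    · exact key C h D h'
    · exact (key D h' C h).symm
    · exact hQd C h D h' hne
  · rw [Finset.union_biUnion, hQu, ← Finset.union_biUnion, Finset.sdiff_union_of_subset hS, hPu]
  · refine Finset.disjoint_left.2 fun C hC hC' => ?_
    exact (hQn C hC').ne_empty (disjoint_self.1 (key C hC C hC'))

end Partitions

section Dilworth

variable {V : Type*} [Fintype V] [DecidableEq V] {H : Finset V → ℝ} {α : ℝ}

theorem fHash_of_nonempty {X : Finset V} (hX : X.Nonempty) :
    fHash H α X = α - H Finset.univ + H X := by
  simp [fHash, hX.ne_empty]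

theorem dilworth_le {X : Finset V} {P : Finset (Finset V)} (hP : IsPartitionOf X P) :
    dilworth H α X ≤ ∑ C ∈ P, fHash H α C := by
  refine csInf_le (Set.Finite.bddBelow ?_) ⟨P, hP, rfl⟩
  refine (Set.finite_range fun P : Finset (Finset V) => ∑ C ∈ P, fHash H α C).subset ?_
  rintro s ⟨Q, -, rfl⟩
  exact ⟨Q, rfl⟩

theorem dilworth_le_fHash {X : Finset V} (hX : X.Nonempty) : dilworth H α X ≤ fHash H α X := by
  simpa using dilworth_le (H := H) (α := α) (isPartitionOf_singleton hX)

theorem le_dilworth {X : Finset V} (hX : X.Nonempty) {a : ℝ}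
    (h : ∀ P, IsPartitionOf X P → a ≤ ∑ C ∈ P, fHash H α C) : a ≤ dilworth H α X := by
  refine le_csInf ⟨_, {X}, isPartitionOf_singleton hX, rfl⟩ ?_
  rintro s ⟨P, hP, rfl⟩
  exact h P hP

theorem sum_le_dilworth {r : V → ℝ} (hr : ∀ Y : Finset V, Y.Nonempty → ∑ i ∈ Y, r i ≤ fHash H α Y)
    {X : Finset V} (hX : X.Nonempty) : ∑ i ∈ X, r i ≤ dilworth H α X :=
  le_dilworth hX fun _ hP =>
    (hP.sum_sum r).symm.trans_le (Finset.sum_le_sum fun C hC => hr C (hP.1 C hC))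

theorem IsPolymatroid.fHash_union_add_inter_le (hH : IsPolymatroid H) {X Y : Finset V}
    (hXY : (X ∩ Y).Nonempty) :
    fHash H α (X ∪ Y) + fHash H α (X ∩ Y) ≤ fHash H α X + fHash H α Y := by
  have hX : X.Nonempty := hXY.mono Finset.inter_subset_left
  have hY : Y.Nonempty := hXY.mono Finset.inter_subset_right
  rw [fHash_of_nonempty hXY, fHash_of_nonempty hX, fHash_of_nonempty hY,
    fHash_of_nonempty (hX.mono Finset.subset_union_left)]
  linarith [hH.2.2 X Y]

theorem IsPartitionOf.sum_fHash {P : Finset (Finset V)} {X : Finset V} (hP : IsPartitionOf X P) :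
    ∑ C ∈ P, fHash H α C = P.card * α - ∑ C ∈ P, (H Finset.univ - H C) := by
  rw [Finset.sum_congr rfl fun C hC => fHash_of_nonempty (hP.1 C hC)]
  simp only [Finset.sum_add_distrib, Finset.sum_sub_distrib, Finset.sum_const, nsmul_eq_mul]
  ring

/-- If the blocks of `S` are pairwise disjoint and meet `X`, uncrossing `X` with them one by one. -/
theorem IsPolymatroid.fHash_union_biUnion_le (hH : IsPolymatroid H) {X : Finset V}
    (S : Finset (Finset V)) (hd : ∀ C ∈ S, ∀ D ∈ S, C ≠ D → Disjoint C D)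
    (hX : ∀ C ∈ S, (X ∩ C).Nonempty) :
    fHash H α (X ∪ S.biUnion id) + ∑ C ∈ S, fHash H α (X ∩ C) ≤
      fHash H α X + ∑ C ∈ S, fHash H α C := by
  induction S using Finset.induction_on with
  | empty => simp
  | insert C S hC ih =>
    have ih := ih (fun D hD E hE => hd D (Finset.mem_insert_of_mem hD) E
      (Finset.mem_insert_of_mem hE)) fun D hD => hX D (Finset.mem_insert_of_mem hD)
    have hdisj : Disjoint (S.biUnion id) C := by
      refine (Finset.disjoint_biUnion_left _ _ _).2 fun D hD => ?_
      exact hd D (Finset.mem_insert_of_mem hD) C (Finset.mem_insert_self C S)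
        fun h => hC (h ▸ hD)
    have hinter : (X ∪ S.biUnion id) ∩ C = X ∩ C := by
      rw [Finset.union_inter_distrib_right, Finset.disjoint_iff_inter_eq_empty.1 hdisj,
        Finset.union_empty]
    have hunion : X ∪ (insert C S).biUnion id = X ∪ S.biUnion id ∪ C := by
      rw [Finset.biUnion_insert, id, Finset.union_comm C, Finset.union_assoc]
    have hsub := hH.fHash_union_add_inter_le (α := α)
      (hinter.symm ▸ hX C (Finset.mem_insert_self C S))
    rw [hinter] at hsub
    rw [Finset.sum_insert hC, Finset.sum_insert hC, hunion]
    linarith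

theorem le_sum_fHash {R : ℝ}
    (hR : ∀ P, IsPartitionOf Finset.univ P → 2 ≤ P.card → phi H P ≤ R) [Nonempty V]
    {P : Finset (Finset V)} (hP : IsPartitionOf Finset.univ P) :
    R ≤ ∑ C ∈ P, fHash H R C := by
  rcases lt_or_ge P.card 2 with h | h
  · have hne : P.Nonempty := by
      rw [Finset.nonempty_iff_ne_empty]
      rintro rfl
      exact Finset.univ_nonempty.ne_empty (hP.2.2.symm.trans Finset.biUnion_empty)
    obtain ⟨C, rfl⟩ := Finset.card_eq_one.1 (le_antisymm (Nat.le_of_lt_succ h) hne.card_pos)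
    have hC : C = Finset.univ := by simpa using hP.2.2
    simp [hC, fHash_of_nonempty Finset.univ_nonempty]
  · have h2 : (2 : ℝ) ≤ P.card := by exact_mod_cast h
    have := hR P hP h
    rw [phi, div_le_iff₀ (by linarith)] at this
    rw [hP.sum_fHash]
    linarith

theorem sum_fHash_eq {R : ℝ} {P : Finset (Finset V)} (hP : IsPartitionOf Finset.univ P)
    (h2 : 2 ≤ P.card) (hR : phi H P = R) : ∑ C ∈ P, fHash H R C = R := by
  have h2' : (2 : ℝ) ≤ P.card := by exact_mod_cast h2
  rw [phi, div_eq_iff (by linarith)] at hR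
  rw [hP.sum_fHash]
  linarith

theorem mem_RCO_iff {r : V → ℝ} {R : ℝ} (hr : ∑ i, r i = R) :
    r ∈ RCO H ↔ ∀ X : Finset V, X.Nonempty → ∑ i ∈ X, r i ≤ fHash H R X := by
  constructor
  · intro h X hX
    have hlt : Finset.univ \ X ⊂ Finset.univ := Finset.sdiff_ssubset (Finset.subset_univ X) hX
    have := h _ hlt
    rw [Finset.sdiff_sdiff_eq_self (Finset.subset_univ X)] at this
    rw [fHash_of_nonempty hX]
    linarith [Finset.sum_sdiff (f := r) (Finset.subset_univ X)]
  · intro h X hX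
    have hne : (Finset.univ \ X).Nonempty := Finset.sdiff_nonempty.2 hX.2
    have := h _ hne
    rw [fHash_of_nonempty hne] at this
    linarith [Finset.sum_sdiff (f := r) (Finset.subset_univ X)]

end Dilworth

section TightPartitions

variable {V : Type*} [Fintype V] [DecidableEq V] {H : Finset V → ℝ} {R : ℝ}
  {P : Finset (Finset V)}

theorem sum_fHash_le_of_tight (hmin : ∀ Q, IsPartitionOf Finset.univ Q → R ≤ ∑ C ∈ Q, fHash H R C)
    (hP : IsPartitionOf Finset.univ P) (hPR : ∑ C ∈ P, fHash H R C = R)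
    {S Q : Finset (Finset V)} (hS : S ⊆ P) (hQ : IsPartitionOf (S.biUnion id) Q) :
    ∑ C ∈ S, fHash H R C ≤ ∑ C ∈ Q, fHash H R C := by
  obtain ⟨hpart, hdisj⟩ := hP.replace hS hQ
  have h := hmin _ hpart
  rw [Finset.sum_union hdisj] at h
  linarith [Finset.sum_sdiff (f := fHash H R) hS]

theorem dilworth_eq_fHash_of_tight
    (hmin : ∀ Q, IsPartitionOf Finset.univ Q → R ≤ ∑ C ∈ Q, fHash H R C)
    (hP : IsPartitionOf Finset.univ P) (hPR : ∑ C ∈ P, fHash H R C = R)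
    {C : Finset V} (hC : C ∈ P) : dilworth H R C = fHash H R C := by
  refine le_antisymm (dilworth_le_fHash (hP.1 C hC)) (le_dilworth (hP.1 C hC) fun Q hQ => ?_)
  simpa using sum_fHash_le_of_tight hmin hP hPR (Finset.singleton_subset_iff.2 hC)
    (Q := Q) (by simpa using hQ)

theorem sum_le_fHash_of_inBC (hH : IsPolymatroid H)
    (hmin : ∀ Q, IsPartitionOf Finset.univ Q → R ≤ ∑ C ∈ Q, fHash H R C)
    (hP : IsPartitionOf Finset.univ P) (hPR : ∑ C ∈ P, fHash H R C = R)
    {r : V → ℝ} (hr : ∀ C ∈ P, InBC H R C r) {X : Finset V} (hX : X.Nonempty) :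
    ∑ i ∈ X, r i ≤ fHash H R X := by
  let S := P.filter fun C => (X ∩ C).Nonempty
  have hSP : S ⊆ P := Finset.filter_subset _ _
  have hXS : ∀ C ∈ S, (X ∩ C).Nonempty := fun C hC => (Finset.mem_filter.1 hC).2
  have hXU : X ⊆ S.biUnion id := by
    intro i hi
    obtain ⟨C, hC, hiC⟩ := Finset.mem_biUnion.1 (hP.2.2.symm ▸ Finset.mem_univ i)
    exact Finset.mem_biUnion.2
      ⟨C, Finset.mem_filter.2 ⟨hC, i, Finset.mem_inter.2 ⟨hi, hiC⟩⟩, hiC⟩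
  have huncross := hH.fHash_union_biUnion_le (α := R) S
    (fun C hC D hD => hP.2.1 C (hSP hC) D (hSP hD)) hXS
  rw [Finset.union_eq_right.2 hXU] at huncross
  have hU := sum_fHash_le_of_tight hmin hP hPR hSP (isPartitionOf_singleton (hX.mono hXU))
  rw [Finset.sum_singleton] at hU
  have hblock : ∑ C ∈ S, ∑ i ∈ X ∩ C, r i ≤ ∑ C ∈ S, fHash H R (X ∩ C) :=
    Finset.sum_le_sum fun C hC =>
      ((hr C (hSP hC)).1 _ (hXS C hC) Finset.inter_subset_right).trans
        (dilworth_le_fHash (hXS C hC))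
  have hsum : ∑ C ∈ S, ∑ i ∈ X ∩ C, r i = ∑ i ∈ X, r i := by
    rw [← hP.sum_inter r (Finset.subset_univ X)]
    refine Finset.sum_subset hSP fun C hC hCS => ?_
    have : X ∩ C = ∅ := by
      rw [← Finset.not_nonempty_iff_eq_empty]
      exact fun h => hCS (Finset.mem_filter.2 ⟨hC, h⟩)
    rw [this, Finset.sum_empty]
  linarith

theorem inBC_of_sum_le_fHash (hP : IsPartitionOf Finset.univ P)
    (hPR : ∑ C ∈ P, fHash H R C = R) {r : V → ℝ}
    (hr : ∀ X : Finset V, X.Nonempty → ∑ i ∈ X, r i ≤ fHash H R X) (hrR : ∑ i, r i = R)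
    {C : Finset V} (hC : C ∈ P) : InBC H R C r := by
  have heq := (Finset.sum_eq_sum_iff_of_le fun D hD => hr D (hP.1 D hD)).1
    ((hP.sum_sum r).trans (hrR.trans hPR.symm)) C hC
  exact ⟨fun X hX _ => sum_le_dilworth hr hX, le_antisymm (sum_le_dilworth hr (hP.1 C hC))
    ((dilworth_le_fHash (hP.1 C hC)).trans heq.ge)⟩

end TightPartitions

/-- Decomposition of separable convex minimization by the fundamental partition: if `r*`
minimizes `Σ_{i∈C} g_i` over `B_C` for every block `C` of the fundamental partition, then
`r*` is an optimal rate vector minimizing `Σ_{i∈V} g_i` over the optimal rate vector set. -/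
theorem stmt_17 {V : Type*} [Fintype V] [DecidableEq V] (hV : 2 ≤ Fintype.card V)
    (H : Finset V → ℝ) (hH : IsPolymatroid H) (R : ℝ)
    (hR : IsGreatest { s : ℝ | ∃ P : Finset (Finset V),
      IsPartitionOf Finset.univ P ∧ 2 ≤ P.card ∧ s = phi H P } R)
    (Pstar : Finset (Finset V)) (hPstar : IsPartitionOf Finset.univ Pstar)
    (hPstar2 : 2 ≤ Pstar.card) (hPopt : phi H Pstar = R)
    (hfinest : ∀ P : Finset (Finset V), IsPartitionOf Finset.univ P → 2 ≤ P.card →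
      phi H P = R → ∀ C ∈ Pstar, ∃ D ∈ P, C ⊆ D)
    (g : V → ℝ → ℝ) (hg : ∀ i : V, ConvexOn ℝ Set.univ (g i))
    (rstar : V → ℝ)
    (hrstar : ∀ C ∈ Pstar, InBC H R C rstar ∧
      ∀ ρ : V → ℝ, InBC H R C ρ → ∑ i ∈ C, g i (rstar i) ≤ ∑ i ∈ C, g i (ρ i)) :
    rstar ∈ RCO H ∧ ∑ i, rstar i = R ∧
      ∀ r ∈ RCO H, ∑ i, r i = R → ∑ i, g i (rstar i) ≤ ∑ i, g i (r i) := by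
  have : Nonempty V := Fintype.card_pos_iff.1 (by omega)
  have hmin : ∀ Q, IsPartitionOf Finset.univ Q → R ≤ ∑ C ∈ Q, fHash H R C := fun Q hQ =>
    le_sum_fHash (fun P hP h2 => hR.2 ⟨P, hP, h2, rfl⟩) hQ
  have hPR := sum_fHash_eq hPstar hPstar2 hPopt
  have hsum : ∑ i, rstar i = R := by
    rw [← hPstar.sum_sum, ← hPR]
    refine Finset.sum_congr rfl fun C hC => ?_
    rw [(hrstar C hC).1.2, dilworth_eq_fHash_of_tight hmin hPstar hPR hC]
  refine ⟨(mem_RCO_iff hsum).2 fun X hX => sum_le_fHash_of_inBC hH hmin hPstar hPR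
    (fun C hC => (hrstar C hC).1) hX, hsum, fun r hr hrR => ?_⟩
  rw [← hPstar.sum_sum, ← hPstar.sum_sum]
  exact Finset.sum_le_sum fun C hC => (hrstar C hC).2 r
    (inBC_of_sum_le_fHash hPstar hPR ((mem_RCO_iff hrR).1 hr) hrR hC)
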